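/- Let U⁻, U⁰, U⁺ be the subalgebras of U_{r,s}(𝔤) generated by {f_i : i ∈ I}, by {ω_i^{±1}, ω_i'^{±1} : i ∈ I}, and by {e_i : i ∈ I}, respectively. Then the multiplication map U⁻ ⊗ U⁰ ⊗ U⁺ → U_{r,s}(𝔤), y ⊗ t ⊗ x ↦ y t x, is an isomorphism of ℚ(r,s)-vector spaces (triangular decomposition). -/

import Mathlib

noncomputable section

/-- The q-integer `(m)_v = 1 + v + ⋯ + v^{m-1}`. -/
def qnat {K : Type} [CommRing K] (v : K) (m : ℕ) : K := ∑ i ∈ Finset.range m, v ^ i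

/-- The Gaussian binomial coefficient `binom(m,k)_v`, as a polynomial expression in `v`
(defined through the Pascal-type recurrence). -/
def qbinom {K : Type} [CommRing K] (v : K) : ℕ → ℕ → K
  | _, 0 => 1
  | 0, _ + 1 => 0
  | m + 1, k + 1 => qbinom v m k + v ^ (k + 1) * qbinom v m (k + 1)

/-- The Euler (Ringel) form on basis elements: `⟨α_i, α_j⟩ = d_i a_{ij}` if `i < j`,
`d_i` if `i = j`, and `0` if `i > j`. -/
def eulB {n : ℕ} (a : Fin n → Fin n → ℤ) (d : Fin n → ℤ) (i j : Fin n) : ℤ :=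
  if i < j then d i * a i j else if i = j then d i else 0

/-- The Euler form on the root lattice `Q = Fin n → ℤ` (coordinates in the basis `α_i`). -/
def euler {n : ℕ} (a : Fin n → Fin n → ℤ) (d : Fin n → ℤ) (μ ν : Fin n → ℤ) : ℤ :=
  ∑ i, ∑ j, μ i * ν j * eulB a d i j

/-- The coefficient `c^{(k)}_{ij} = (r_i s_i⁻¹)^{k(k-1)/2} r^{k⟨α_j,α_i⟩} s^{-k⟨α_i,α_j⟩}`. -/
def ccoef {K : Type} [Field K] {n : ℕ} (a : Fin n → Fin n → ℤ) (d : Fin n → ℤ)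
    (r s : K) (i j : Fin n) (k : ℕ) : K :=
  (r ^ d i * (s ^ d i)⁻¹) ^ (k * (k - 1) / 2) *
    r ^ ((k : ℤ) * eulB a d j i) * (s ^ ((k : ℤ) * eulB a d i j))⁻¹

/-- The `(r,s)`-Serre element
`∑_{k=0}^{1-a_{ij}} (-1)^k binom(1-a_{ij},k)_{r_i s_i⁻¹} c^{(k)}_{ij} E_i^{1-a_{ij}-k} E_j E_i^k`. -/
def serreElt {K : Type} [Field K] {n : ℕ} (a : Fin n → Fin n → ℤ) (d : Fin n → ℤ)
    (r s : K) {A : Type} [Ring A] [Algebra K A] (E : Fin n → A) (i j : Fin n) : A :=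
  ∑ k ∈ Finset.range ((1 - a i j).toNat + 1),
    ((-1 : K) ^ k * qbinom (r ^ d i * (s ^ d i)⁻¹) ((1 - a i j).toNat) k *
        ccoef a d r s i j k) •
      (E i ^ ((1 - a i j).toNat - k) * E j * E i ^ k)

/-- The defining relations of `U⁺_{r,s}`: the `(r,s)`-Serre relations. -/
inductive SerreRel (K : Type) [Field K] {n : ℕ} (a : Fin n → Fin n → ℤ) (d : Fin n → ℤ)
    (r s : K) : FreeAlgebra K (Fin n) → FreeAlgebra K (Fin n) → Prop
  | rel (i j : Fin n) (h : i ≠ j) :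
      SerreRel K a d r s (serreElt a d r s (FreeAlgebra.ι K) i j) 0

/-- `U⁺_{r,s}`: the algebra generated by the `e_i` subject only to the `(r,s)`-Serre
relations. -/
abbrev Uplus (K : Type) [Field K] {n : ℕ} (a : Fin n → Fin n → ℤ) (d : Fin n → ℤ)
    (r s : K) : Type := RingQuot (SerreRel K a d r s)

/-- The generator `e_i` of `U⁺_{r,s}`. -/
def eP (K : Type) [Field K] {n : ℕ} (a : Fin n → Fin n → ℤ) (d : Fin n → ℤ)
    (r s : K) (i : Fin n) : Uplus K a d r s :=
  RingQuot.mkAlgHom K (SerreRel K a d r s) (FreeAlgebra.ι K i)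

/-- The degree-`μ` homogeneous component of `U⁺_{r,s}` for `μ ∈ Q⁺`: the span of the
monomials in the `e_i` in which `e_i` occurs exactly `μ i` times. -/
def UplusDeg (K : Type) [Field K] {n : ℕ} (a : Fin n → Fin n → ℤ) (d : Fin n → ℤ)
    (r s : K) (μ : Fin n → ℕ) : Submodule K (Uplus K a d r s) :=
  Submodule.span K
    {x | ∃ w : List (Fin n), (∀ i, w.count i = μ i) ∧ x = (w.map (eP K a d r s)).prod}

/-- The `(r,s)`-Serre element for the negative generators:
`∑_{k=0}^{1-a_{ij}} (-1)^k binom(1-a_{ij},k)_{r_i s_i⁻¹} c^{(k)}_{ij} F_i^k F_j F_i^{1-a_{ij}-k}`. -/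
def serreEltF {K : Type} [Field K] {n : ℕ} (a : Fin n → Fin n → ℤ) (d : Fin n → ℤ)
    (r s : K) {A : Type} [Ring A] [Algebra K A] (F : Fin n → A) (i j : Fin n) : A :=
  ∑ k ∈ Finset.range ((1 - a i j).toNat + 1),
    ((-1 : K) ^ k * qbinom (r ^ d i * (s ^ d i)⁻¹) ((1 - a i j).toNat) k *
        ccoef a d r s i j k) •
      (F i ^ k * F j * F i ^ ((1 - a i j).toNat - k))

/-- The field `ℚ(r,s)` of rational functions in two variables over `ℚ`. -/
abbrev K2 : Type := FractionRing (MvPolynomial (Fin 2) ℚ)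

/-- The parameter `r ∈ ℚ(r,s)`. -/
def rr : K2 := algebraMap (MvPolynomial (Fin 2) ℚ) K2 (MvPolynomial.X 0)

/-- The parameter `s ∈ ℚ(r,s)`. -/
def ss : K2 := algebraMap (MvPolynomial (Fin 2) ℚ) K2 (MvPolynomial.X 1)

/-- Generators of the two-parameter quantum group `U_{r,s}(𝔤)`:
`e_i, f_i, ω_i^{±1}, ω_i'^{±1}`. -/
inductive Gen (n : ℕ) : Type
  | e (i : Fin n) : Gen n
  | f (i : Fin n) : Gen n
  | w (i : Fin n) : Gen n
  | winv (i : Fin n) : Gen n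
  | w' (i : Fin n) : Gen n
  | w'inv (i : Fin n) : Gen n

/-- The four toral generators `ω_i, ω_i^{-1}, ω_i', ω_i'^{-1}` attached to `i`. -/
def tor {n : ℕ} (i : Fin n) : Bool → Bool → Gen n
  | false, false => Gen.w i
  | false, true => Gen.winv i
  | true, false => Gen.w' i
  | true, true => Gen.w'inv i

/-- The defining relations (R1)–(R6) of the two-parameter quantum group `U_{r,s}(𝔤)`. -/
inductive URel {n : ℕ} (a : Fin n → Fin n → ℤ) (d : Fin n → ℤ) :
    FreeAlgebra K2 (Gen n) → FreeAlgebra K2 (Gen n) → Prop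
  | torComm (i j : Fin n) (p q p' q' : Bool) :
      URel a d (FreeAlgebra.ι K2 (tor i p q) * FreeAlgebra.ι K2 (tor j p' q'))
        (FreeAlgebra.ι K2 (tor j p' q') * FreeAlgebra.ι K2 (tor i p q))
  | wInvR (i : Fin n) :
      URel a d (FreeAlgebra.ι K2 (Gen.w i) * FreeAlgebra.ι K2 (Gen.winv i)) 1
  | wInvL (i : Fin n) :
      URel a d (FreeAlgebra.ι K2 (Gen.winv i) * FreeAlgebra.ι K2 (Gen.w i)) 1
  | w'InvR (i : Fin n) :
      URel a d (FreeAlgebra.ι K2 (Gen.w' i) * FreeAlgebra.ι K2 (Gen.w'inv i)) 1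
  | w'InvL (i : Fin n) :
      URel a d (FreeAlgebra.ι K2 (Gen.w'inv i) * FreeAlgebra.ι K2 (Gen.w' i)) 1
  | we (i j : Fin n) :
      URel a d (FreeAlgebra.ι K2 (Gen.w i) * FreeAlgebra.ι K2 (Gen.e j))
        ((rr ^ eulB a d j i * (ss ^ eulB a d i j)⁻¹) •
          (FreeAlgebra.ι K2 (Gen.e j) * FreeAlgebra.ι K2 (Gen.w i)))
  | w'e (i j : Fin n) :
      URel a d (FreeAlgebra.ι K2 (Gen.w' i) * FreeAlgebra.ι K2 (Gen.e j))
        (((rr ^ eulB a d i j)⁻¹ * ss ^ eulB a d j i) •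
          (FreeAlgebra.ι K2 (Gen.e j) * FreeAlgebra.ι K2 (Gen.w' i)))
  | wf (i j : Fin n) :
      URel a d (FreeAlgebra.ι K2 (Gen.w i) * FreeAlgebra.ι K2 (Gen.f j))
        (((rr ^ eulB a d j i)⁻¹ * ss ^ eulB a d i j) •
          (FreeAlgebra.ι K2 (Gen.f j) * FreeAlgebra.ι K2 (Gen.w i)))
  | w'f (i j : Fin n) :
      URel a d (FreeAlgebra.ι K2 (Gen.w' i) * FreeAlgebra.ι K2 (Gen.f j))
        ((rr ^ eulB a d i j * (ss ^ eulB a d j i)⁻¹) •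
          (FreeAlgebra.ι K2 (Gen.f j) * FreeAlgebra.ι K2 (Gen.w' i)))
  | ef (i j : Fin n) :
      URel a d
        (FreeAlgebra.ι K2 (Gen.e i) * FreeAlgebra.ι K2 (Gen.f j) -
          FreeAlgebra.ι K2 (Gen.f j) * FreeAlgebra.ι K2 (Gen.e i))
        (if i = j then
          ((rr ^ d i - ss ^ d i)⁻¹) •
            (FreeAlgebra.ι K2 (Gen.w i) - FreeAlgebra.ι K2 (Gen.w' i))
         else 0)
  | serreE (i j : Fin n) (h : i ≠ j) :
      URel a d (serreElt a d rr ss (fun k => FreeAlgebra.ι K2 (Gen.e k)) i j) 0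
  | serreF (i j : Fin n) (h : i ≠ j) :
      URel a d (serreEltF a d rr ss (fun k => FreeAlgebra.ι K2 (Gen.f k)) i j) 0

/-- The two-parameter quantum group `U_{r,s}(𝔤)` over `ℚ(r,s)`. -/
abbrev Uq {n : ℕ} (a : Fin n → Fin n → ℤ) (d : Fin n → ℤ) : Type :=
  RingQuot (URel a d)

/-- The image of a generator in `U_{r,s}(𝔤)`. -/
def gU {n : ℕ} (a : Fin n → Fin n → ℤ) (d : Fin n → ℤ) (x : Gen n) : Uq a d :=
  RingQuot.mkAlgHom K2 (URel a d) (FreeAlgebra.ι K2 x)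

/-- The subalgebra `U⁺` of `U_{r,s}(𝔤)` generated by the `e_i`. -/
def Upos {n : ℕ} (a : Fin n → Fin n → ℤ) (d : Fin n → ℤ) : Subalgebra K2 (Uq a d) :=
  Algebra.adjoin K2 (Set.range fun i => gU a d (Gen.e i))

/-- The subalgebra `U⁻` of `U_{r,s}(𝔤)` generated by the `f_i`. -/
def Uneg {n : ℕ} (a : Fin n → Fin n → ℤ) (d : Fin n → ℤ) : Subalgebra K2 (Uq a d) :=
  Algebra.adjoin K2 (Set.range fun i => gU a d (Gen.f i))

/-- The subalgebra `U⁰` of `U_{r,s}(𝔤)` generated by the `ω_i^{±1}, ω_i'^{±1}`. -/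
def Uzero {n : ℕ} (a : Fin n → Fin n → ℤ) (d : Fin n → ℤ) : Subalgebra K2 (Uq a d) :=
  Algebra.adjoin K2 (Set.range fun p : Fin n × Bool × Bool => gU a d (tor p.1 p.2.1 p.2.2))

/-- The generator `e_i` of `U⁺ ⊆ U_{r,s}(𝔤)`, as an element of the subalgebra `U⁺`. -/
def eUp {n : ℕ} (a : Fin n → Fin n → ℤ) (d : Fin n → ℤ) (i : Fin n) : ↥(Upos a d) :=
  ⟨gU a d (Gen.e i), Algebra.subset_adjoin (Set.mem_range_self i)⟩

open TensorProduct

set_option synthInstance.maxHeartbeats 1000000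
set_option maxHeartbeats 1000000

section SerreElements

variable {K : Type} [Field K]

/-- The iterated skew commutator `y ↦ y x - p^m c x y`; the `N`-th one is the Serre element
`∑ (-1)^k binom(N,k)_p p^{k(k-1)/2} c^k x^k y x^{N-k}`. -/
def skewAd {S : Type} [Ring S] [Algebra K S] (p c : K) (x y : S) : ℕ → S
  | 0 => y
  | m + 1 => skewAd p c x y m * x - (p ^ m * c) • (x * skewAd p c x y m)

/-- The mirror image of `skewAd`: the iterated skew commutator `y ↦ x y - p^m c y x`. -/
def skewAd' {S : Type} [Ring S] [Algebra K S] (p c : K) (x y : S) : ℕ → S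
  | 0 => y
  | m + 1 => x * skewAd' p c x y m - (p ^ m * c) • (skewAd' p c x y m * x)

variable {S R : Type} [Ring S] [Algebra K S] [Ring R] [Algebra K R]

theorem map_skewAd (φ : S →ₐ[K] R) (p c : K) (x y : S) (m : ℕ) :
    φ (skewAd p c x y m) = skewAd p c (φ x) (φ y) m := by
  induction m with
  | zero => rfl
  | succ m ih => simp [skewAd, ih]

theorem op_skewAd' (p c : K) (x y : S) (m : ℕ) :
    MulOpposite.op (skewAd' p c x y m) =
      skewAd p c (MulOpposite.op x) (MulOpposite.op y) m := by
  induction m with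
  | zero => rfl
  | succ m ih => simp [skewAd, skewAd', ← ih]

theorem map_skewAd' (φ : S →ₐ[K] R) (p c : K) (x y : S) (m : ℕ) :
    φ (skewAd' p c x y m) = skewAd' p c (φ x) (φ y) m := by
  induction m with
  | zero => rfl
  | succ m ih => simp [skewAd', ih]

theorem skewAd_smul (p c α β : K) (x y : S) (m : ℕ) :
    skewAd p c (α • x) (β • y) m = (α ^ m * β) • skewAd p c x y m := by
  induction m with
  | zero => simp [skewAd]
  | succ m ih =>
    simp only [skewAd, ih, smul_mul_assoc, mul_smul_comm, smul_smul, smul_sub]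
    congr 2 <;> ring

theorem skewAd_succ_left (p c : K) (x y : S) (m : ℕ) :
    skewAd p c x y (m + 1) = skewAd p (p * c) x (y * x - c • (x * y)) m := by
  induction m with
  | zero => simp [skewAd]
  | succ m ih =>
    rw [skewAd, ih, skewAd, pow_succ, mul_assoc]

theorem qbinom_eq_zero (v : K) {m k : ℕ} (h : m < k) : qbinom v m k = 0 := by
  induction m generalizing k with
  | zero => obtain ⟨k, rfl⟩ := Nat.exists_eq_succ_of_ne_zero h.ne'; rfl
  | succ m ih =>
    obtain ⟨k, rfl⟩ := Nat.exists_eq_succ_of_ne_zero (Nat.ne_zero_of_lt h)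
    rw [qbinom, ih (by omega), ih (by omega)]; simp

theorem skewAd_eq_sum (p c : K) (x y : S) (m : ℕ) :
    skewAd p c x y m = ∑ k ∈ Finset.range (m + 1),
      ((-1 : K) ^ k * qbinom p m k * (p ^ (k * (k - 1) / 2) * c ^ k)) •
        (x ^ k * y * x ^ (m - k)) := by
  induction m generalizing c y with
  | zero => simp [skewAd, qbinom]
  | succ m ih =>
    have h1 : ∀ k ∈ Finset.range (m + 1),
        ((-1 : K) ^ k * qbinom p m k * (p ^ (k * (k - 1) / 2) * (p * c) ^ k)) •
          (x ^ k * (y * x - c • (x * y)) * x ^ (m - k)) =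
        ((-1 : K) ^ k * qbinom p m k * (p ^ (k * (k - 1) / 2) * (p * c) ^ k)) •
          (x ^ k * y * x ^ (m + 1 - k)) +
        (-((-1 : K) ^ k * qbinom p m k * (p ^ (k * (k - 1) / 2) * (p * c) ^ k)) * c) •
          (x ^ (k + 1) * y * x ^ (m - k)) := by
      intro k hk
      have hk' : m + 1 - k = (m - k) + 1 := by
        have := Finset.mem_range.1 hk; omega
      rw [hk', pow_succ' x (m - k), pow_succ x k]
      simp only [mul_sub, sub_mul, mul_smul_comm, smul_mul_assoc, smul_sub, smul_smul,
        mul_assoc, neg_mul, neg_smul, ← sub_eq_add_neg]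
    rw [skewAd_succ_left, ih, Finset.sum_congr rfl h1, Finset.sum_add_distrib,
      Finset.sum_range_succ' _ (m + 1), Finset.sum_range_succ' _ m, add_right_comm]
    have h2 : ∑ k ∈ Finset.range m,
        ((-1 : K) ^ (k + 1) * qbinom p m (k + 1) *
          (p ^ ((k + 1) * (k + 1 - 1) / 2) * (p * c) ^ (k + 1))) •
            (x ^ (k + 1) * y * x ^ (m + 1 - (k + 1))) =
        ∑ k ∈ Finset.range (m + 1),
        ((-1 : K) ^ (k + 1) * qbinom p m (k + 1) *
          (p ^ ((k + 1) * (k + 1 - 1) / 2) * (p * c) ^ (k + 1))) •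
            (x ^ (k + 1) * y * x ^ (m + 1 - (k + 1))) := by
      rw [Finset.sum_range_succ, qbinom_eq_zero p (Nat.lt_succ_self m)]; simp
    rw [h2, ← Finset.sum_add_distrib]
    congr 1
    · refine Finset.sum_congr rfl fun k _ => ?_
      rw [show m + 1 - (k + 1) = m - k by omega, ← add_smul, Nat.triangle_succ, qbinom]
      congr 1
      ring
    · cases m <;> simp [qbinom]

theorem skewAd'_eq_sum (p c : K) (x y : S) (m : ℕ) :
    skewAd' p c x y m = ∑ k ∈ Finset.range (m + 1),
      ((-1 : K) ^ k * qbinom p m k * (p ^ (k * (k - 1) / 2) * c ^ k)) •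
        (x ^ (m - k) * y * x ^ k) := by
  apply MulOpposite.op_injective
  rw [op_skewAd', skewAd_eq_sum]
  simp [mul_assoc]

/-! ### Skew derivations and Serre elements -/

variable {φ ψ : S →ₐ[K] R} {D : S →ₗ[K] R}

theorem skewDer_skewAd_of_left_zero (hD : ∀ x y, D (x * y) = φ x * D y + D x * ψ y)
    {p c q₁ q₂ : K} {x y : S} {w₁ w₂ : R} (hx : D x = 0) (hy : D y = w₁ + w₂)
    (h₁ : w₁ * ψ x = q₁ • (φ x * w₁)) (h₂ : w₂ * ψ x = q₂ • (φ x * w₂)) (m : ℕ) :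
    D (skewAd p c x y m) =
      (∏ l ∈ Finset.range m, (q₁ - p ^ l * c)) • (φ x ^ m * w₁) +
      (∏ l ∈ Finset.range m, (q₂ - p ^ l * c)) • (φ x ^ m * w₂) := by
  induction m with
  | zero => simp [skewAd, hy]
  | succ m ih =>
    have hc : ∀ {q : K} {w : R}, w * ψ x = q • (φ x * w) →
        φ x ^ m * w * ψ x = q • (φ x ^ (m + 1) * w) := fun h => by
      rw [mul_assoc, h, mul_smul_comm, pow_succ, mul_assoc]
    rw [skewAd, map_sub, map_smul, hD, hD, hx, ih, mul_zero, zero_mul, zero_add, add_zero,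
      add_mul, mul_add, smul_mul_assoc, smul_mul_assoc, hc h₁, hc h₂, Finset.prod_range_succ,
      Finset.prod_range_succ, mul_smul_comm, mul_smul_comm, ← mul_assoc, ← mul_assoc, ← pow_succ']
    module

theorem skewDer_skewAd_of_right_zero (hD : ∀ x y, D (x * y) = φ x * D y + D x * ψ y)
    {p c c' : K} (hp : p ≠ 0) (hc : c ≠ 0) {x y : S} {w₁ w₂ : R}
    (hx : D x = w₁ + w₂) (hy : D y = 0)
    (h₁x : w₁ * ψ x = p⁻¹ • (φ x * w₁)) (h₁y : w₁ * ψ y = c⁻¹ • (φ y * w₁))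
    (h₂x : w₂ * ψ x = p • (φ x * w₂)) (h₂y : w₂ * ψ y = c' • (φ y * w₂)) (m : ℕ) :
    D (skewAd p c x y (m + 1)) =
      (qnat p (m + 1) * (1 - p ^ m * c * c')) • (φ (skewAd p c x y m) * w₂) := by
  have comm : ∀ {q t : K} {w : R}, w * ψ x = q • (φ x * w) → w * ψ y = t • (φ y * w) →
      ∀ m, w * ψ (skewAd p c x y m) = (q ^ m * t) • (φ (skewAd p c x y m) * w) := by
    intro q t w hx hy m
    induction m with
    | zero => simpa [skewAd] using hy
    | succ m ih =>
      have e1 : w * (ψ (skewAd p c x y m) * ψ x) =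
          (q ^ (m + 1) * t) • (φ (skewAd p c x y m) * φ x * w) := by
        rw [← mul_assoc, ih, smul_mul_assoc, mul_assoc, hx, mul_smul_comm, smul_smul,
          ← mul_assoc (φ _)]
        congr 1; ring
      have e2 : w * (ψ x * ψ (skewAd p c x y m)) =
          (q ^ (m + 1) * t) • (φ x * φ (skewAd p c x y m) * w) := by
        rw [← mul_assoc, hx, smul_mul_assoc, mul_assoc, ih, mul_smul_comm, smul_smul,
          ← mul_assoc (φ _)]
        congr 1; ring
      simp only [skewAd, map_sub, map_smul, map_mul, mul_sub, mul_smul_comm, sub_mul,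
        smul_mul_assoc, e1, e2]
      module
  have step : ∀ m, D (skewAd p c x y (m + 1)) =
      D (skewAd p c x y m) * ψ x - (p ^ m * c) • (φ x * D (skewAd p c x y m)) +
        (1 - p ^ m * c * (p ^ m * c')) • (φ (skewAd p c x y m) * w₂) := by
    intro m
    have e1 := comm h₁x h₁y m
    have e2 := comm h₂x h₂y m
    have hk : p ^ m * c * (p⁻¹ ^ m * c⁻¹) = 1 := by
      rw [inv_pow]; field_simp
    have e3 : (p ^ m * c) • (w₁ * ψ (skewAd p c x y m)) = φ (skewAd p c x y m) * w₁ := by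
      rw [e1, smul_smul, hk, one_smul]
    rw [skewAd, map_sub, map_smul, hD, hD, hx, add_mul, mul_add, smul_add, smul_add, e3, e2]
    module
  induction m with
  | zero => rw [step]; simp [skewAd, hy, qnat]
  | succ m ih =>
    have hq : qnat p (m + 1 + 1) = p * qnat p (m + 1) + 1 := by
      simp [qnat, Finset.sum_range_succ' _ (m + 1), Finset.mul_sum, pow_succ']
    have hq' : qnat p (m + 1 + 1) = qnat p (m + 1) + p ^ (m + 1) := by
      simp [qnat, Finset.sum_range_succ _ (m + 1)]
    have e : φ (skewAd p c x y m) * w₂ * ψ x = p • (φ (skewAd p c x y m) * φ x * w₂) := by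
      rw [mul_assoc, h₂x, mul_smul_comm, mul_assoc]
    rw [step, ih, smul_mul_assoc, e, mul_smul_comm, ← mul_assoc]
    have hs : φ (skewAd p c x y (m + 1)) * w₂ = φ (skewAd p c x y m) * φ x * w₂ -
        (p ^ m * c) • (φ x * φ (skewAd p c x y m) * w₂) := by
      simp [skewAd, sub_mul]
    have hcoef : qnat p (m + 1 + 1) * (1 - p ^ (m + 1) * c * c') =
        p * (qnat p (m + 1) * (1 - p ^ m * c * c')) +
          (1 - p ^ (m + 1) * c * (p ^ (m + 1) * c')) := by
      linear_combination hq - p ^ (m + 1) * c * c' * hq'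
    rw [hcoef, add_smul, hs]
    module

theorem skewDer_skewAd_of_zero (hD : ∀ x y, D (x * y) = φ x * D y + D x * ψ y)
    {p c : K} {x y : S} (hx : D x = 0) (hy : D y = 0) (m : ℕ) :
    D (skewAd p c x y m) = 0 := by
  induction m with
  | zero => exact hy
  | succ m ih => simp [skewAd, hD, hx, ih]

end SerreElements

theorem RingQuot.left_induction {K X : Type} [CommRing K]
    {r : FreeAlgebra K X → FreeAlgebra K X → Prop} {p : RingQuot r → Prop} (one : p 1)
    (add : ∀ x y, p x → p y → p (x + y)) (smul : ∀ (c : K) x, p x → p (c • x))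
    (gen_mul : ∀ x y, p y → p (RingQuot.mkAlgHom K r (FreeAlgebra.ι K x) * y))
    (z : RingQuot r) : p z := by
  obtain ⟨w, rfl⟩ := RingQuot.mkAlgHom_surjective K r z
  have key : ∀ w : FreeAlgebra K X, ∀ y, p y → p (RingQuot.mkAlgHom K r w * y) := by
    intro w
    induction w using FreeAlgebra.induction with
    | grade0 c => intro y hy; rw [AlgHom.commutes, ← Algebra.smul_def]; exact smul c y hy
    | grade1 x => exact gen_mul x
    | mul a b ha hb => intro y hy; rw [map_mul, mul_assoc]; exact ha _ (hb _ hy)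
    | add a b ha hb => intro y hy; rw [map_add, add_mul]; exact add _ _ (ha _ hy) (hb _ hy)
  simpa using key w 1 one

theorem RingQuot.adjoin_range_mkAlgHom_ι {K X : Type} [CommRing K]
    (r : FreeAlgebra K X → FreeAlgebra K X → Prop) :
    Algebra.adjoin K (Set.range fun x => RingQuot.mkAlgHom K r (FreeAlgebra.ι K x)) = ⊤ := by
  have h := AlgHom.map_adjoin (RingQuot.mkAlgHom K r) (Set.range (FreeAlgebra.ι K))
  rw [FreeAlgebra.adjoin_range_ι, Algebra.map_top, ← Set.range_comp] at h
  exact h.symm.trans ((AlgHom.range_eq_top _).2 (RingQuot.mkAlgHom_surjective K r))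

/-- A braiding matrix of Cartan type: `P i j` is the scalar by which `ω_i` and `e_j` skew commute,
`κ i` scales the commutator of `e_i` and `f_i`, and `N i j = 1 - a_{ij}`. -/
structure QuantumDatum (K ι : Type) [Field K] where
  P : ι → ι → K
  κ : ι → K
  N : ι → ι → ℕ
  P_ne_zero : ∀ i j, P i j ≠ 0
  N_ne_zero : ∀ i j, i ≠ j → N i j ≠ 0
  cartan : ∀ i j, i ≠ j → P i j * P j i * P i i ^ N i j = P i i

namespace QuantumDatum

variable {K ι : Type} [Field K] (D : QuantumDatum K ι)

/-- The scalar by which the toral generator `g` and `e_j` skew commute. -/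
def weight (g : ι × Bool × Bool) (j : ι) : K :=
  match g with
  | (i, false, false) => D.P i j
  | (i, false, true) => (D.P i j)⁻¹
  | (i, true, false) => (D.P j i)⁻¹
  | (i, true, true) => D.P j i

theorem weight_ne_zero (g : ι × Bool × Bool) (j : ι) : D.weight g j ≠ 0 := by
  obtain ⟨i, _ | _, _ | _⟩ := g <;> simp [weight, D.P_ne_zero]

theorem weight_mul_inv (i j : ι) (b : Bool) :
    D.weight (i, b, false) j * D.weight (i, b, true) j = 1 := by
  cases b <;> simp [weight, D.P_ne_zero]

theorem weight_inv_eq (k : ι) (b : Bool) :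
    (fun l => (D.weight (k, b, false) l)⁻¹) = (fun l => (D.P k l)⁻¹) ∨
      (fun l => (D.weight (k, b, false) l)⁻¹) = fun l => D.P l k := by
  cases b
  · exact Or.inl rfl
  · exact Or.inr (by simp [weight])

/-- Families satisfying the relations of the quantum group attached to `D` other than the Serre
relations. -/
structure PreRealization [DecidableEq ι] {R : Type} [Ring R] [Algebra K R] (e f : ι → R)
    (t : ι × Bool × Bool → R) : Prop where
  t_comm : ∀ g h, t g * t h = t h * t g
  t_inv : ∀ i b, t (i, b, false) * t (i, b, true) = 1
  t_e : ∀ g j, t g * e j = D.weight g j • (e j * t g)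
  t_f : ∀ g j, t g * f j = (D.weight g j)⁻¹ • (f j * t g)
  e_f : ∀ i j, e i * f j - f j * e i =
    if i = j then D.κ i • (t (i, false, false) - t (i, true, false)) else 0

/-- Families satisfying the relations of the quantum group attached to `D`. -/
structure Realization [DecidableEq ι] {R : Type} [Ring R] [Algebra K R] (e f : ι → R)
    (t : ι × Bool × Bool → R) : Prop extends D.PreRealization e f t where
  serre_e : ∀ i j, i ≠ j → skewAd' (D.P i i) (D.P i j) (e i) (e j) (D.N i j) = 0
  serre_f : ∀ i j, i ≠ j → skewAd (D.P i i) (D.P i j) (f i) (f j) (D.N i j) = 0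

/-- The relations of the negative part. -/
inductive NegRel : FreeAlgebra K ι → FreeAlgebra K ι → Prop
  | serre (i j : ι) (h : i ≠ j) : NegRel
      (skewAd (D.P i i) (D.P i j) (FreeAlgebra.ι K i) (FreeAlgebra.ι K j) (D.N i j)) 0

/-- The relations of the positive part. -/
inductive PosRel : FreeAlgebra K ι → FreeAlgebra K ι → Prop
  | serre (i j : ι) (h : i ≠ j) : PosRel
      (skewAd' (D.P i i) (D.P i j) (FreeAlgebra.ι K i) (FreeAlgebra.ι K j) (D.N i j)) 0

/-- The relations of the torus. -/
inductive TorRel (K ι : Type) [Field K] :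
    FreeAlgebra K (ι × Bool × Bool) → FreeAlgebra K (ι × Bool × Bool) → Prop
  | comm (g h : ι × Bool × Bool) : TorRel K ι
      (FreeAlgebra.ι K g * FreeAlgebra.ι K h) (FreeAlgebra.ι K h * FreeAlgebra.ι K g)
  | inv (i : ι) (b : Bool) : TorRel K ι
      (FreeAlgebra.ι K (i, b, false) * FreeAlgebra.ι K (i, b, true)) 1

/-- The algebra presented by the Serre relations between the `f_i`. -/
abbrev Neg : Type := RingQuot D.NegRel

/-- The algebra presented by the Serre relations between the `e_i`. -/
abbrev Pos : Type := RingQuot D.PosRel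

/-- The algebra presented by the relations between the toral generators. -/
abbrev Tor (K ι : Type) [Field K] : Type := RingQuot (TorRel K ι)

/-- The generators of the negative part. -/
def negGen (i : ι) : D.Neg := RingQuot.mkAlgHom K D.NegRel (FreeAlgebra.ι K i)

/-- The generators of the positive part. -/
def posGen (i : ι) : D.Pos := RingQuot.mkAlgHom K D.PosRel (FreeAlgebra.ι K i)

/-- The generators of the torus. -/
def torGen (K : Type) {ι : Type} [Field K] (g : ι × Bool × Bool) : Tor K ι :=
  RingQuot.mkAlgHom K (TorRel K ι) (FreeAlgebra.ι K g)

theorem negGen_serre {i j : ι} (h : i ≠ j) :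
    skewAd (D.P i i) (D.P i j) (D.negGen i) (D.negGen j) (D.N i j) = 0 := by
  have := RingQuot.mkAlgHom_rel K (NegRel.serre (D := D) i j h)
  rwa [map_skewAd, map_zero] at this

theorem posGen_serre {i j : ι} (h : i ≠ j) :
    skewAd' (D.P i i) (D.P i j) (D.posGen i) (D.posGen j) (D.N i j) = 0 := by
  have := RingQuot.mkAlgHom_rel K (PosRel.serre (D := D) i j h)
  rwa [map_skewAd', map_zero] at this

theorem torGen_comm (g h : ι × Bool × Bool) :
    torGen K g * torGen K h = torGen K h * torGen K g := by
  simpa [torGen] using RingQuot.mkAlgHom_rel K (TorRel.comm (K := K) g h)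

theorem torGen_inv (i : ι) (b : Bool) :
    torGen K (i, b, false) * torGen K (i, b, true) = 1 := by
  simpa [torGen] using RingQuot.mkAlgHom_rel K (TorRel.inv (K := K) i b)

section Lift

variable {R : Type} [Ring R] [Algebra K R]

/-- The universal property of the negative part. -/
def negLift (f : ι → R)
    (h : ∀ i j, i ≠ j → skewAd (D.P i i) (D.P i j) (f i) (f j) (D.N i j) = 0) :
    D.Neg →ₐ[K] R :=
  RingQuot.liftAlgHom K ⟨FreeAlgebra.lift K f, by
    rintro _ _ ⟨i, j, hij⟩
    simpa [map_skewAd] using h i j hij⟩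

@[simp]
theorem negLift_gen (f : ι → R)
    (h : ∀ i j, i ≠ j → skewAd (D.P i i) (D.P i j) (f i) (f j) (D.N i j) = 0) (i : ι) :
    D.negLift f h (D.negGen i) = f i := by
  simp [negLift, negGen]

/-- The universal property of the positive part. -/
def posLift (e : ι → R)
    (h : ∀ i j, i ≠ j → skewAd' (D.P i i) (D.P i j) (e i) (e j) (D.N i j) = 0) :
    D.Pos →ₐ[K] R :=
  RingQuot.liftAlgHom K ⟨FreeAlgebra.lift K e, by
    rintro _ _ ⟨i, j, hij⟩
    simpa [map_skewAd'] using h i j hij⟩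

@[simp]
theorem posLift_gen (e : ι → R)
    (h : ∀ i j, i ≠ j → skewAd' (D.P i i) (D.P i j) (e i) (e j) (D.N i j) = 0) (i : ι) :
    D.posLift e h (D.posGen i) = e i := by
  simp [posLift, posGen]

/-- The universal property of the torus. -/
def torLift (t : ι × Bool × Bool → R) (hc : ∀ g h, t g * t h = t h * t g)
    (hi : ∀ i b, t (i, b, false) * t (i, b, true) = 1) : Tor K ι →ₐ[K] R :=
  RingQuot.liftAlgHom K ⟨FreeAlgebra.lift K t, by
    rintro _ _ (⟨g, h⟩ | ⟨i, b⟩)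
    · simpa using hc g h
    · simpa using hi i b⟩

@[simp]
theorem torLift_gen (t : ι × Bool × Bool → R) (hc : ∀ g h, t g * t h = t h * t g)
    (hi : ∀ i b, t (i, b, false) * t (i, b, true) = 1) (g : ι × Bool × Bool) :
    torLift t hc hi (torGen K g) = t g := by
  simp [torLift, torGen]

end Lift

variable {D}

theorem neg_induction {p : D.Neg → Prop} (one : p 1) (add : ∀ x y, p x → p y → p (x + y))
    (smul : ∀ (c : K) x, p x → p (c • x)) (gen_mul : ∀ i y, p y → p (D.negGen i * y))
    (z : D.Neg) : p z :=
  RingQuot.left_induction one add smul gen_mul z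

theorem pos_induction {p : D.Pos → Prop} (one : p 1) (add : ∀ x y, p x → p y → p (x + y))
    (smul : ∀ (c : K) x, p x → p (c • x)) (gen_mul : ∀ i y, p y → p (D.posGen i * y))
    (z : D.Pos) : p z :=
  RingQuot.left_induction one add smul gen_mul z

theorem tor_induction {p : Tor K ι → Prop} (one : p 1) (add : ∀ x y, p x → p y → p (x + y))
    (smul : ∀ (c : K) x, p x → p (c • x)) (gen_mul : ∀ g y, p y → p (torGen K g * y))
    (z : Tor K ι) : p z :=
  RingQuot.left_induction one add smul gen_mul z

variable (D)

/-- Rescaling the generators of the negative part. -/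
def negScale (c : ι → K) : D.Neg →ₐ[K] D.Neg :=
  D.negLift (fun i => c i • D.negGen i) fun i j h => by
    rw [skewAd_smul, D.negGen_serre h, smul_zero]

/-- Rescaling the generators of the torus. -/
def torScale (c : ι × Bool × Bool → K) (hc : ∀ i b, c (i, b, false) * c (i, b, true) = 1) :
    Tor K ι →ₐ[K] Tor K ι :=
  torLift (fun g => c g • torGen K g)
    (fun g h => by
      simp only [smul_mul_assoc, mul_smul_comm, smul_smul, torGen_comm g h, mul_comm (c g)])
    (fun i b => by
      rw [smul_mul_smul_comm, torGen_inv, hc, one_smul])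

@[simp]
theorem negScale_gen (c : ι → K) (i : ι) : D.negScale c (D.negGen i) = c i • D.negGen i := by
  simp [negScale]

@[simp]
theorem torScale_gen (c : ι × Bool × Bool → K)
    (hc : ∀ i b, c (i, b, false) * c (i, b, true) = 1) (g : ι × Bool × Bool) :
    torScale c hc (torGen K g) = c g • torGen K g := by
  simp [torScale]

theorem negScale_negScale (c c' : ι → K) (y : D.Neg) :
    D.negScale c (D.negScale c' y) = D.negScale (c * c') y := by
  induction y using neg_induction with
  | one => simp
  | add x y hx hy => simp [hx, hy]
  | smul a x hx => simp [hx]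
  | gen_mul i y hy => simp [hy, smul_smul, mul_comm (c i)]

theorem negScale_one (y : D.Neg) : D.negScale 1 y = y := by
  induction y using neg_induction with
  | one => simp
  | add x y hx hy => simp [hx, hy]
  | smul a x hx => simp [hx]
  | gen_mul i y hy => simp [hy]

/-- A skew derivation that behaves on the generators like the commutator with the `k`-th
generator of the opposite part kills the Serre elements. -/
theorem skewDer_serre [DecidableEq ι] {S R : Type} [Ring S] [Algebra K S] [Ring R] [Algebra K R]
    {φ ψ : S →ₐ[K] R} {δ : S →ₗ[K] R} (hδ : ∀ x y, δ (x * y) = φ x * δ y + δ x * ψ y)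
    {f : ι → S} {k : ι} {w₁ w₂ : R} (hf : ∀ l, δ (f l) = if k = l then w₁ + w₂ else 0)
    (h₁ : ∀ l, w₁ * ψ (f l) = (D.P k l)⁻¹ • (φ (f l) * w₁))
    (h₂ : ∀ l, w₂ * ψ (f l) = D.P l k • (φ (f l) * w₂)) {i j : ι} (hij : i ≠ j) :
    δ (skewAd (D.P i i) (D.P i j) (f i) (f j) (D.N i j)) = 0 := by
  obtain ⟨m, hm⟩ := Nat.exists_eq_succ_of_ne_zero (D.N_ne_zero i j hij)
  have hP : D.P i i ^ m * D.P i j * D.P j i = 1 := by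
    have := D.cartan i j hij
    rw [hm, pow_succ] at this
    refine mul_right_cancel₀ (D.P_ne_zero i i) ?_
    linear_combination this
  by_cases hkj : k = j
  · subst hkj
    rw [skewDer_skewAd_of_left_zero hδ (by rw [hf, if_neg hij.symm]) (by rw [hf, if_pos rfl])
      (h₁ i) (h₂ i), hm]
    have e₁ : ∏ l ∈ Finset.range (m + 1), ((D.P k i)⁻¹ - D.P i i ^ l * D.P i k) = 0 :=
      Finset.prod_eq_zero (Finset.self_mem_range_succ m)
        (sub_eq_zero.2 (inv_eq_of_mul_eq_one_left hP))
    have e₂ : ∏ l ∈ Finset.range (m + 1), (D.P i k - D.P i i ^ l * D.P i k) = 0 :=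
      Finset.prod_eq_zero (Finset.mem_range.2 m.succ_pos) (by simp)
    rw [e₁, e₂]; simp
  by_cases hki : k = i
  · subst hki
    rw [hm, skewDer_skewAd_of_right_zero hδ (D.P_ne_zero k k) (D.P_ne_zero k j)
      (by rw [hf, if_pos rfl]) (by rw [hf, if_neg hkj]) (h₁ k) (h₁ j) (h₂ k) (h₂ j), hP]
    simp
  · exact skewDer_skewAd_of_zero hδ (by rw [hf, if_neg hki]) (by rw [hf, if_neg hkj]) _

/-! ### Skew derivations of the negative part -/

variable [DecidableEq ι]

/-- The upper triangular representation whose corner is the `q`-skew derivation `∂_k`. -/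
def derFree (k : ι) (q : ι → K) : FreeAlgebra K ι →ₐ[K] Matrix (Fin 2) (Fin 2) D.Neg :=
  FreeAlgebra.lift K fun l => !![D.negGen l, if k = l then 1 else 0; 0, q l • D.negGen l]

theorem derFree_apply (k : ι) (q : ι → K) (z : FreeAlgebra K ι) :
    D.derFree k q z = !![RingQuot.mkAlgHom K D.NegRel z, D.derFree k q z 0 1;
      0, D.negScale q (RingQuot.mkAlgHom K D.NegRel z)] := by
  suffices h : D.derFree k q z 0 0 = RingQuot.mkAlgHom K D.NegRel z ∧
      D.derFree k q z 1 0 = 0 ∧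
      D.derFree k q z 1 1 = D.negScale q (RingQuot.mkAlgHom K D.NegRel z) by
    ext i j
    fin_cases i <;> fin_cases j <;> simp [h]
  induction z using FreeAlgebra.induction with
  | grade0 c => simp [Matrix.algebraMap_matrix_apply]
  | grade1 x => exact ⟨by simp [derFree]; rfl, by simp [derFree], by
      simp only [derFree, FreeAlgebra.lift_ι_apply]; exact (D.negScale_gen q x).symm⟩
  | mul a b ha hb => simp [Matrix.mul_apply, ha, hb]
  | add a b ha hb => simp [ha, hb]

theorem derFree_serre (k : ι) (q : ι → K)
    (hq : q = (fun l => (D.P k l)⁻¹) ∨ q = fun l => D.P l k) {i j : ι} (hij : i ≠ j) :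
    D.derFree k q (skewAd (D.P i i) (D.P i j) (FreeAlgebra.ι K i) (FreeAlgebra.ι K j) (D.N i j))
      = 0 := by
  have hz := RingQuot.mkAlgHom_rel K (NegRel.serre (D := D) i j hij)
  rw [derFree_apply, hz]
  set δ : FreeAlgebra K ι →ₗ[K] D.Neg :=
    (Matrix.entryLinearMap K D.Neg 0 1) ∘ₗ (D.derFree k q).toLinearMap with hδ
  have hL : ∀ x y, δ (x * y) = RingQuot.mkAlgHom K D.NegRel x * δ y +
      δ x * ((D.negScale q).comp (RingQuot.mkAlgHom K D.NegRel)) y := by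
    intro x y
    have hx := D.derFree_apply k q x
    have hy := D.derFree_apply k q y
    simp only [hδ, LinearMap.comp_apply, AlgHom.toLinearMap_apply, map_mul,
      Matrix.entryLinearMap_apply, AlgHom.comp_apply]
    rw [Matrix.mul_apply, Fin.sum_univ_two, hx, hy]
    simp
  have hf : ∀ l, δ (FreeAlgebra.ι K l) = if k = l then 1 else 0 := by
    intro l; simp [hδ, derFree]
  have hg : ∀ l, ((D.negScale q).comp (RingQuot.mkAlgHom K D.NegRel)) (FreeAlgebra.ι K l) =
      q l • RingQuot.mkAlgHom K D.NegRel (FreeAlgebra.ι K l) := fun l => D.negScale_gen q l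
  have key : δ (skewAd (D.P i i) (D.P i j) (FreeAlgebra.ι K i) (FreeAlgebra.ι K j) (D.N i j))
      = 0 := by
    rcases hq with rfl | rfl
    · exact D.skewDer_serre (w₁ := 1) (w₂ := 0) hL (by simpa using hf) (by simp [hg]) (by simp) hij
    · exact D.skewDer_serre (w₁ := 0) (w₂ := 1) hL (by simpa using hf) (by simp) (by simp [hg]) hij
  have key' : D.derFree k q (skewAd (D.P i i) (D.P i j) (FreeAlgebra.ι K i) (FreeAlgebra.ι K j)
      (D.N i j)) 0 1 = 0 := key
  rw [key']
  ext a b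
  fin_cases a <;> fin_cases b <;> simp

theorem exists_skewDer (k : ι) (q : ι → K)
    (hq : q = (fun l => (D.P k l)⁻¹) ∨ q = fun l => D.P l k) :
    ∃ δ : D.Neg →ₗ[K] D.Neg, δ 1 = 0 ∧ ∀ l y, δ (D.negGen l * y) =
      D.negGen l * δ y + if k = l then D.negScale q y else 0 := by
  let Φ : D.Neg →ₐ[K] Matrix (Fin 2) (Fin 2) D.Neg :=
    RingQuot.liftAlgHom K ⟨D.derFree k q, by
      rintro _ _ ⟨i, j, hij⟩
      rw [map_zero]
      exact D.derFree_serre k q hq hij⟩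
  have hΦ : ∀ z, Φ (RingQuot.mkAlgHom K D.NegRel z) = D.derFree k q z := by simp [Φ]
  refine ⟨(Matrix.entryLinearMap K D.Neg 0 1) ∘ₗ Φ.toLinearMap, by simp, fun l y => ?_⟩
  obtain ⟨z, rfl⟩ := RingQuot.mkAlgHom_surjective K D.NegRel y
  have hz := D.derFree_apply k q z
  simp only [LinearMap.comp_apply, AlgHom.toLinearMap_apply, map_mul,
    Matrix.entryLinearMap_apply, negGen, hΦ]
  rw [Matrix.mul_apply, Fin.sum_univ_two, hz]
  by_cases h : k = l <;> simp [derFree, h, negGen]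

/-- The skew derivation `∂_k` of the negative part attached to `ω_k` (`b = false`)
or `ω'_k` (`b = true`). -/
def der (k : ι) (b : Bool) : D.Neg →ₗ[K] D.Neg :=
  (D.exists_skewDer k (fun l => (D.weight (k, b, false) l)⁻¹) (D.weight_inv_eq k b)).choose

theorem der_one (k : ι) (b : Bool) : D.der k b 1 = 0 :=
  (D.exists_skewDer k _ (D.weight_inv_eq k b)).choose_spec.1

theorem der_gen_mul (k : ι) (b : Bool) (l : ι) (y : D.Neg) :
    D.der k b (D.negGen l * y) = D.negGen l * D.der k b y +
      if k = l then D.negScale (fun l => (D.weight (k, b, false) l)⁻¹) y else 0 :=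
  (D.exists_skewDer k _ (D.weight_inv_eq k b)).choose_spec.2 l y

theorem der_negScale (k : ι) (b : Bool) (c : ι → K) (y : D.Neg) :
    D.der k b (D.negScale c y) = c k • D.negScale c (D.der k b y) := by
  induction y using neg_induction with
  | one => simp [der_one]
  | add x y hx hy => simp [hx, hy]
  | smul a x hx => simp [hx, smul_comm a]
  | gen_mul l y hy =>
    rw [map_mul, negScale_gen, smul_mul_assoc, map_smul, der_gen_mul, der_gen_mul, hy]
    by_cases h : k = l
    · subst h
      rw [if_pos rfl, if_pos rfl, map_add, map_mul, negScale_gen, negScale_negScale,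
        negScale_negScale, mul_comm c, mul_smul_comm, smul_mul_assoc]
    · rw [if_neg h, if_neg h, add_zero, add_zero, map_mul, negScale_gen, mul_smul_comm,
        smul_mul_assoc, smul_comm]

end QuantumDatum

section

variable {K : Type} [Field K]

theorem mul_skewAd' {R : Type} [Ring R] [Algebra K R] {w x y : R} {α β : K}
    (hx : w * x = α • (x * w)) (hy : w * y = β • (y * w)) (p c : K) (m : ℕ) :
    w * skewAd' p c x y m = (α ^ m * β) • (skewAd' p c x y m * w) := by
  induction m with
  | zero => simpa [skewAd'] using hy
  | succ m ih =>
    have e1 : w * (x * skewAd' p c x y m) = (α ^ (m + 1) * β) • (x * skewAd' p c x y m * w) := by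
      rw [← mul_assoc, hx, smul_mul_assoc, mul_assoc, ih, mul_smul_comm, smul_smul, ← mul_assoc x]
      congr 1; ring
    have e2 : w * (skewAd' p c x y m * x) = (α ^ (m + 1) * β) • (skewAd' p c x y m * x * w) := by
      rw [← mul_assoc, ih, smul_mul_assoc, mul_assoc, hx, mul_smul_comm, smul_smul,
        ← mul_assoc (skewAd' p c x y m)]
      congr 1; ring
    simp only [skewAd', mul_sub, mul_smul_comm, sub_mul, smul_mul_assoc, e1, e2]
    module

variable {V A : Type} [AddCommGroup V] [Module K V] [Ring A] [Algebra K A]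
  {X Y : Module.End K V} {x y : A} {j : A →ₗ[K] V}

theorem skewAd_apply_intertwine (hX : ∀ a, X (j a) = j (x * a)) (hY : ∀ a, Y (j a) = j (y * a))
    (p c : K) (m : ℕ) (a : A) : skewAd p c X Y m (j a) = j (skewAd p c x y m * a) := by
  induction m generalizing a with
  | zero => exact hY a
  | succ m ih => simp [skewAd, hX, ih, sub_mul, mul_assoc]

theorem skewAd'_apply_intertwine (hX : ∀ a, X (j a) = j (x * a)) (hY : ∀ a, Y (j a) = j (y * a))
    (p c : K) (m : ℕ) (a : A) : skewAd' p c X Y m (j a) = j (skewAd' p c x y m * a) := by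
  induction m generalizing a with
  | zero => exact hY a
  | succ m ih => simp [skewAd', hX, ih, sub_mul, mul_assoc]

end

namespace QuantumDatum

variable {K ι : Type} [Field K] (D : QuantumDatum K ι)

/-- The space underlying the regular representation of the quantum group. -/
abbrev Triangular : Type := (D.Neg ⊗[K] Tor K ι) ⊗[K] D.Pos

instance : AddCommGroup D.Triangular := Module.addCommMonoidToAddCommGroup K

/-- The rescaling of the torus induced by moving `e_i` across it. -/
def torShift (i : ι) : Tor K ι →ₐ[K] Tor K ι :=
  torScale (fun g => (D.weight g i)⁻¹) fun j b => by
    rw [← mul_inv, D.weight_mul_inv, inv_one]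

/-- The action of `f_j`. -/
def opF (j : ι) : Module.End K D.Triangular :=
  TensorProduct.map (TensorProduct.map (LinearMap.mulLeft K (D.negGen j)) LinearMap.id)
    LinearMap.id

/-- The action of a toral generator. -/
def opT (g : ι × Bool × Bool) : Module.End K D.Triangular :=
  TensorProduct.map (TensorProduct.map (D.negScale fun l => (D.weight g l)⁻¹).toLinearMap
    (LinearMap.mulLeft K (torGen K g))) LinearMap.id

/-- The part of the action of `e_i` that multiplies the positive part. -/
def opMul (i : ι) : Module.End K D.Triangular :=
  TensorProduct.map (TensorProduct.map LinearMap.id (D.torShift i).toLinearMap)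
    (LinearMap.mulLeft K (D.posGen i))

variable (y : D.Neg) (u : Tor K ι) (x : D.Pos)

@[simp]
theorem torShift_gen (i : ι) (g : ι × Bool × Bool) :
    D.torShift i (torGen K g) = (D.weight g i)⁻¹ • torGen K g := by
  simp [torShift]

@[simp]
theorem opF_tmul (j : ι) : D.opF j ((y ⊗ₜ u) ⊗ₜ x) = ((D.negGen j * y) ⊗ₜ u) ⊗ₜ x := rfl

@[simp]
theorem opT_tmul (g : ι × Bool × Bool) : D.opT g ((y ⊗ₜ u) ⊗ₜ x) =
    (D.negScale (fun l => (D.weight g l)⁻¹) y ⊗ₜ (torGen K g * u)) ⊗ₜ x := rfl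

@[simp]
theorem opMul_tmul (i : ι) : D.opMul i ((y ⊗ₜ u) ⊗ₜ x) =
    (y ⊗ₜ D.torShift i u) ⊗ₜ (D.posGen i * x) := rfl

theorem opT_opMul (g : ι × Bool × Bool) (i : ι) :
    D.opT g * D.opMul i = D.weight g i • (D.opMul i * D.opT g) := by
  refine TensorProduct.ext_threefold fun y u x => ?_
  simp only [Module.End.mul_apply, LinearMap.smul_apply, opT_tmul, opMul_tmul, map_mul,
    torShift_gen, smul_mul_assoc, TensorProduct.tmul_smul, ← TensorProduct.smul_tmul', smul_smul,
    mul_inv_cancel₀ (D.weight_ne_zero g i), one_smul]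

theorem opMul_opF (i j : ι) : D.opMul i * D.opF j = D.opF j * D.opMul i := by
  refine TensorProduct.ext_threefold fun y u x => ?_
  simp

theorem opF_serre {i j : ι} (h : i ≠ j) :
    skewAd (D.P i i) (D.P i j) (D.opF i) (D.opF j) (D.N i j) = 0 := by
  refine TensorProduct.ext_threefold fun y u x => ?_
  have := skewAd_apply_intertwine (X := D.opF i) (Y := D.opF j) (x := D.negGen i)
    (y := D.negGen j)
    (j := (TensorProduct.mk K _ D.Pos).flip x ∘ₗ (TensorProduct.mk K D.Neg (Tor K ι)).flip u)
    (fun _ => rfl) (fun _ => rfl) (D.P i i) (D.P i j) (D.N i j) y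
  rw [D.negGen_serre h, zero_mul, map_zero] at this
  exact this

variable [DecidableEq ι]

theorem PreRealization.serre_e_mul_f {D : QuantumDatum K ι} {R : Type} [Ring R]
    [Algebra K R] {e f : ι → R} {t : ι × Bool × Bool → R} (H : D.PreRealization e f t) {i j : ι} (hij : i ≠ j) (k : ι) :
    skewAd' (D.P i i) (D.P i j) (e i) (e j) (D.N i j) * f k =
      f k * skewAd' (D.P i i) (D.P i j) (e i) (e j) (D.N i j) := by
  let δ : Rᵐᵒᵖ →ₗ[K] Rᵐᵒᵖ :=
    LinearMap.mulRight K (MulOpposite.op (f k)) - LinearMap.mulLeft K (MulOpposite.op (f k))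
  have hδ : ∀ z, δ z = z * MulOpposite.op (f k) - MulOpposite.op (f k) * z := fun z => rfl
  have key := D.skewDer_serre (φ := AlgHom.id K Rᵐᵒᵖ) (ψ := AlgHom.id K Rᵐᵒᵖ) (δ := δ)
    (f := fun l => MulOpposite.op (e l)) (k := k)
    (w₁ := -D.κ k • MulOpposite.op (t (k, false, false)))
    (w₂ := D.κ k • MulOpposite.op (t (k, true, false)))
    (fun x y => by simp only [hδ, AlgHom.id_apply]; noncomm_ring)
    (fun l => by
      have h := H.e_f l k
      rw [hδ, ← MulOpposite.op_mul, ← MulOpposite.op_mul, ← MulOpposite.op_sub, ← neg_sub, h]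
      by_cases hl : k = l
      · subst hl
        simp only [if_pos, MulOpposite.op_neg, MulOpposite.op_smul, MulOpposite.op_sub]
        module
      · rw [if_neg hl, if_neg (Ne.symm hl)]; simp)
    (fun l => by
      have h : t (k, false, false) * e l = D.P k l • (e l * t (k, false, false)) := H.t_e _ l
      simp only [AlgHom.id_apply, smul_mul_assoc, mul_smul_comm, ← MulOpposite.op_mul, h,
        MulOpposite.op_smul, smul_smul]
      congr 1
      field_simp [D.P_ne_zero k l])
    (fun l => by
      have h : t (k, true, false) * e l = (D.P l k)⁻¹ • (e l * t (k, true, false)) := H.t_e _ l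
      simp only [AlgHom.id_apply, smul_mul_assoc, mul_smul_comm, ← MulOpposite.op_mul, h,
        MulOpposite.op_smul, smul_smul]
      congr 1
      field_simp [D.P_ne_zero l k])
    hij
  rw [← op_skewAd', hδ, ← MulOpposite.op_mul, ← MulOpposite.op_mul, ← MulOpposite.op_sub,
    MulOpposite.op_eq_zero_iff, sub_eq_zero] at key
  exact key.symm

/-- The part of the action of `e_i` that comes from a skew derivation. -/
def opDer (i : ι) (b : Bool) : Module.End K D.Triangular :=
  TensorProduct.map (TensorProduct.map (D.der i b)
    (LinearMap.mulLeft K (torGen K (i, b, false)))) LinearMap.id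

/-- The action of `e_i`. -/
def opE (i : ι) : Module.End K D.Triangular :=
  D.opMul i + D.κ i • (D.opDer i false - D.opDer i true)

@[simp]
theorem opDer_tmul (i : ι) (b : Bool) : D.opDer i b ((y ⊗ₜ u) ⊗ₜ x) =
    (D.der i b y ⊗ₜ (torGen K (i, b, false) * u)) ⊗ₜ x := rfl

theorem opE_apply (i : ι) (v : D.Triangular) :
    D.opE i v = D.opMul i v + D.κ i • (D.opDer i false v - D.opDer i true v) := rfl

theorem opT_opDer (g : ι × Bool × Bool) (i : ι) (b : Bool) :
    D.opT g * D.opDer i b = D.weight g i • (D.opDer i b * D.opT g) := by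
  refine TensorProduct.ext_threefold fun y u x => ?_
  simp only [Module.End.mul_apply, LinearMap.smul_apply, opT_tmul, opDer_tmul, der_negScale,
    ← mul_assoc, torGen_comm g, ← TensorProduct.smul_tmul', smul_smul,
    mul_inv_cancel₀ (D.weight_ne_zero g i), one_smul]

theorem opDer_opF (i j : ι) (b : Bool) : D.opDer i b * D.opF j =
    D.opF j * D.opDer i b + if i = j then D.opT (i, b, false) else 0 := by
  refine TensorProduct.ext_threefold fun y u x => ?_
  split_ifs with h <;>
  simp [der_gen_mul, h, TensorProduct.add_tmul]

theorem preRealization_op : D.PreRealization D.opE D.opF D.opT where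
  t_comm g h := by
    refine TensorProduct.ext_threefold fun y u x => ?_
    simp only [Module.End.mul_apply, opT_tmul, negScale_negScale, ← mul_assoc, torGen_comm g h]
    rw [mul_comm (fun l => (D.weight g l)⁻¹)]
  t_inv i b := by
    refine TensorProduct.ext_threefold fun y u x => ?_
    have h : ((fun l => (D.weight (i, b, false) l)⁻¹) * fun l => (D.weight (i, b, true) l)⁻¹) =
        1 := by
      ext l
      simp [← mul_inv_rev, mul_comm, D.weight_mul_inv]
    simp only [Module.End.mul_apply, opT_tmul, negScale_negScale, ← mul_assoc, torGen_inv, h,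
      negScale_one, one_mul, Module.End.one_apply]
  t_e g j := by
    simp only [opE, mul_add, add_mul, mul_sub, sub_mul, mul_smul_comm, smul_mul_assoc, opT_opDer,
      opT_opMul]
    module
  t_f g j := by
    refine TensorProduct.ext_threefold fun y u x => ?_
    simp [TensorProduct.smul_tmul']
  e_f i j := by
    simp only [opE, mul_add, add_mul, mul_sub, sub_mul, mul_smul_comm, smul_mul_assoc, opDer_opF,
      opMul_opF]
    split_ifs with h
    · module
    · module

theorem opE_one_one (i : ι) :
    D.opE i ((1 ⊗ₜ 1) ⊗ₜ x) = ((1 : D.Neg) ⊗ₜ (1 : Tor K ι)) ⊗ₜ (D.posGen i * x) := by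
  simp [opE_apply, der_one]

theorem opE_serre {i j : ι} (h : i ≠ j) :
    skewAd' (D.P i i) (D.P i j) (D.opE i) (D.opE j) (D.N i j) = 0 := by
  set S := skewAd' (D.P i i) (D.P i j) (D.opE i) (D.opE j) (D.N i j) with hS
  have H := D.preRealization_op
  have hF : ∀ k v, S v = 0 → S (D.opF k v) = 0 := fun k v hv => by
    rw [← Module.End.mul_apply, hS, H.serre_e_mul_f h, Module.End.mul_apply, ← hS, hv, map_zero]
  have hT : ∀ g v, S v = 0 → S (D.opT g v) = 0 := fun g v hv => by
    have e := LinearMap.congr_fun (mul_skewAd' (H.t_e g i) (H.t_e g j) (D.P i i) (D.P i j)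
      (D.N i j)) v
    rw [← hS, Module.End.mul_apply, hv, map_zero, LinearMap.smul_apply, Module.End.mul_apply] at e
    refine (smul_eq_zero.1 e.symm).resolve_left ?_
    exact mul_ne_zero (pow_ne_zero _ (D.weight_ne_zero g i)) (D.weight_ne_zero g j)
  refine TensorProduct.ext_threefold fun y u x => ?_
  rw [LinearMap.zero_apply]
  induction y using neg_induction with
  | add y y' hy hy' =>
    rw [TensorProduct.add_tmul, TensorProduct.add_tmul, map_add, hy, hy', add_zero]
  | smul c y hy =>
    rw [← TensorProduct.smul_tmul', ← TensorProduct.smul_tmul', map_smul, hy, smul_zero]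
  | gen_mul k y hy => exact hF k _ hy
  | one =>
    induction u using tor_induction with
    | add y y' hy hy' =>
      rw [TensorProduct.tmul_add, TensorProduct.add_tmul, map_add, hy, hy', add_zero]
    | smul c y hy =>
      rw [TensorProduct.tmul_smul, ← TensorProduct.smul_tmul', map_smul, hy, smul_zero]
    | gen_mul g u hu => simpa using hT g _ hu
    | one =>
      have := skewAd'_apply_intertwine (X := D.opE i) (Y := D.opE j) (x := D.posGen i)
        (y := D.posGen j)
        (j := TensorProduct.mk K _ D.Pos ((1 : D.Neg) ⊗ₜ[K] (1 : Tor K ι)))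
        (D.opE_one_one · i) (D.opE_one_one · j) (D.P i i) (D.P i j) (D.N i j) x
      rw [D.posGen_serre h, zero_mul, map_zero] at this
      exact this

theorem realization_op : D.Realization D.opE D.opF D.opT where
  toPreRealization := D.preRealization_op
  serre_e _ _ := D.opE_serre
  serre_f _ _ := D.opF_serre

end QuantumDatum

section Multiplication

variable {K A B C R : Type} [Field K] [Ring A] [Algebra K A] [Ring B] [Algebra K B] [Ring C]
  [Algebra K C] [Ring R] [Algebra K R]

/-- The map `(a ⊗ b) ⊗ c ↦ α a * β b * γ c`. -/
def tripleMul (α : A →ₐ[K] R) (β : B →ₐ[K] R) (γ : C →ₐ[K] R) : (A ⊗[K] B) ⊗[K] C →ₗ[K] R :=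
  LinearMap.mul' K R ∘ₗ TensorProduct.map
    (LinearMap.mul' K R ∘ₗ TensorProduct.map α.toLinearMap β.toLinearMap) γ.toLinearMap

theorem exists_equiv_of_bijective_tripleMul {α : A →ₐ[K] R} {β : B →ₐ[K] R} {γ : C →ₐ[K] R}
    (h : Function.Bijective (tripleMul α β γ)) {S₁ S₂ S₃ : Subalgebra K R} (h₁ : α.range = S₁)
    (h₂ : β.range = S₂) (h₃ : γ.range = S₃) :
    ∃ T : (S₁ ⊗[K] S₂) ⊗[K] S₃ ≃ₗ[K] R, ∀ (a : S₁) (b : S₂) (c : S₃),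
      T ((a ⊗ₜ b) ⊗ₜ c) = (a : R) * b * c := by
  subst h₁ h₂ h₃
  set p : (A ⊗[K] B) ⊗[K] C →ₗ[K] (α.range ⊗[K] β.range) ⊗[K] γ.range :=
    TensorProduct.map (TensorProduct.map α.rangeRestrict.toLinearMap β.rangeRestrict.toLinearMap)
      γ.rangeRestrict.toLinearMap
  have hp : Function.Surjective p :=
    TensorProduct.map_surjective (TensorProduct.map_surjective α.rangeRestrict_surjective
      β.rangeRestrict_surjective) γ.rangeRestrict_surjective
  have hm : ∀ v, tripleMul α.range.val β.range.val γ.range.val (p v) = tripleMul α β γ v :=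
    LinearMap.congr_fun (f := tripleMul α.range.val β.range.val γ.range.val ∘ₗ p)
      (TensorProduct.ext_threefold fun _ _ _ => rfl)
  refine ⟨LinearEquiv.ofBijective (tripleMul α.range.val β.range.val γ.range.val) ⟨?_, ?_⟩,
    fun _ _ _ => rfl⟩
  · intro v w hvw
    obtain ⟨v, rfl⟩ := hp v
    obtain ⟨w, rfl⟩ := hp w
    rw [hm, hm] at hvw
    rw [h.1 hvw]
  · intro z
    obtain ⟨v, rfl⟩ := h.2 z
    exact ⟨p v, hm v⟩

end Multiplication

namespace QuantumDatum

variable {K ι : Type} [Field K] {D : QuantumDatum K ι} {R : Type} [Ring R] [Algebra K R]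
  {e f : ι → R} {t : ι × Bool × Bool → R}

theorem range_negLift
    (h : ∀ i j, i ≠ j → skewAd (D.P i i) (D.P i j) (f i) (f j) (D.N i j) = 0) :
    (D.negLift f h).range = Algebra.adjoin K (Set.range f) := by
  rw [← Algebra.map_top, ← RingQuot.adjoin_range_mkAlgHom_ι, AlgHom.map_adjoin, ← Set.range_comp]
  congr 2
  exact funext (D.negLift_gen f h)

theorem range_posLift
    (h : ∀ i j, i ≠ j → skewAd' (D.P i i) (D.P i j) (e i) (e j) (D.N i j) = 0) :
    (D.posLift e h).range = Algebra.adjoin K (Set.range e) := by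
  rw [← Algebra.map_top, ← RingQuot.adjoin_range_mkAlgHom_ι, AlgHom.map_adjoin, ← Set.range_comp]
  congr 2
  exact funext (D.posLift_gen e h)

theorem range_torLift (hc : ∀ g h, t g * t h = t h * t g)
    (hi : ∀ i b, t (i, b, false) * t (i, b, true) = 1) :
    (torLift t hc hi).range = Algebra.adjoin K (Set.range t) := by
  rw [← Algebra.map_top, ← RingQuot.adjoin_range_mkAlgHom_ι, AlgHom.map_adjoin, ← Set.range_comp]
  congr 2
  exact funext (torLift_gen t hc hi)

variable [DecidableEq ι]

namespace Realization

/-- The homomorphism from the negative part attached to a realization. -/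
def neg (H : D.Realization e f t) : D.Neg →ₐ[K] R := D.negLift f H.serre_f

/-- The homomorphism from the positive part attached to a realization. -/
def pos (H : D.Realization e f t) : D.Pos →ₐ[K] R := D.posLift e H.serre_e

/-- The homomorphism from the torus attached to a realization. -/
def torus (H : D.Realization e f t) : Tor K ι →ₐ[K] R := torLift t H.t_comm H.t_inv

variable (H : D.Realization e f t)

@[simp]
theorem neg_gen (i : ι) : H.neg (D.negGen i) = f i := D.negLift_gen _ _ i

@[simp]
theorem pos_gen (i : ι) : H.pos (D.posGen i) = e i := D.posLift_gen _ _ i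

@[simp]
theorem torus_gen (g : ι × Bool × Bool) : H.torus (torGen K g) = t g := torLift_gen _ _ _ g

theorem t_mul_neg (g : ι × Bool × Bool) (y : D.Neg) :
    t g * H.neg y = H.neg (D.negScale (fun l => (D.weight g l)⁻¹) y) * t g := by
  induction y using neg_induction with
  | one => simp
  | add x y hx hy => simp [mul_add, add_mul, hx, hy]
  | smul a x hx => simp [hx]
  | gen_mul l y hy =>
    simp only [map_mul, neg_gen, negScale_gen, map_smul, smul_mul_assoc]
    rw [← mul_assoc, H.t_f, smul_mul_assoc, mul_assoc, hy, ← mul_assoc, mul_assoc]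

theorem e_mul_torus (i : ι) (u : Tor K ι) :
    e i * H.torus u = H.torus (D.torShift i u) * e i := by
  induction u using tor_induction with
  | one => simp
  | add x y hx hy => simp [mul_add, add_mul, hx, hy]
  | smul a x hx => simp [hx]
  | gen_mul g u hu =>
    simp only [map_mul, torus_gen, torShift_gen, map_smul, smul_mul_assoc]
    rw [← mul_assoc, mul_assoc (t g), ← hu, ← mul_assoc, H.t_e, smul_mul_assoc, smul_smul,
      inv_mul_cancel₀ (D.weight_ne_zero g i), one_smul]

theorem e_mul_neg (i : ι) (y : D.Neg) :
    e i * H.neg y = H.neg y * e i + D.κ i • (H.neg (D.der i false y) * t (i, false, false) -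
      H.neg (D.der i true y) * t (i, true, false)) := by
  induction y using neg_induction with
  | one => simp [der_one]
  | add x y hx hy => simp only [map_add, mul_add, add_mul, hx, hy]; module
  | smul a x hx => simp only [map_smul, mul_smul_comm, smul_mul_assoc, hx]; module
  | gen_mul l y hy =>
    have hef := sub_eq_iff_eq_add.1 (H.e_f i l)
    simp only [map_mul, map_add, neg_gen, der_gen_mul]
    rw [← mul_assoc, hef, add_mul, mul_assoc (f l), hy]
    split_ifs with h
    · simp only [smul_mul_assoc, sub_mul, t_mul_neg, mul_add, mul_sub, add_mul, mul_smul_comm,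
        mul_assoc]
      module
    · simp only [mul_add, mul_sub, add_mul, mul_smul_comm, mul_assoc, map_zero, zero_mul]
      module

/-- The multiplication map of a realization. -/
def mulMap : D.Triangular →ₗ[K] R := tripleMul H.neg H.torus H.pos

theorem mulMap_tmul (y : D.Neg) (u : Tor K ι) (x : D.Pos) :
    H.mulMap ((y ⊗ₜ u) ⊗ₜ x) = H.neg y * H.torus u * H.pos x := rfl

theorem mulMap_opF (j : ι) (v : D.Triangular) : H.mulMap (D.opF j v) = f j * H.mulMap v := by
  refine LinearMap.congr_fun (f := H.mulMap ∘ₗ D.opF j)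
    (g := LinearMap.mulLeft K (f j) ∘ₗ H.mulMap)
    (TensorProduct.ext_threefold fun y u x => ?_) v
  simp [mulMap_tmul, mul_assoc]

theorem mulMap_opT (g : ι × Bool × Bool) (v : D.Triangular) :
    H.mulMap (D.opT g v) = t g * H.mulMap v := by
  refine LinearMap.congr_fun (f := H.mulMap ∘ₗ D.opT g)
    (g := LinearMap.mulLeft K (t g) ∘ₗ H.mulMap)
    (TensorProduct.ext_threefold fun y u x => ?_) v
  simp [mulMap_tmul, ← mul_assoc, t_mul_neg]

theorem mulMap_opE (i : ι) (v : D.Triangular) : H.mulMap (D.opE i v) = e i * H.mulMap v := by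
  refine LinearMap.congr_fun (f := H.mulMap ∘ₗ D.opE i)
    (g := LinearMap.mulLeft K (e i) ∘ₗ H.mulMap)
    (TensorProduct.ext_threefold fun y u x => ?_) v
  simp only [LinearMap.comp_apply, LinearMap.mulLeft_apply, opE_apply, map_add, map_smul, map_sub,
    opMul_tmul, opDer_tmul, mulMap_tmul, map_mul, pos_gen, torus_gen]
  rw [← mul_assoc (e i), ← mul_assoc (e i), e_mul_neg, add_mul, mul_assoc (H.neg y) (e i),
    e_mul_torus]
  simp only [add_mul, smul_mul_assoc, sub_mul, mul_assoc]

/-- If the operators on `D.Triangular` extend to a representation of `R`, and `R` is generated by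
the realization, then multiplication is bijective. -/
theorem bijective_mulMap (hgen : Algebra.adjoin K (Set.range e ∪ Set.range f ∪ Set.range t) = ⊤)
    (ρ : R →ₐ[K] Module.End K D.Triangular) (hρe : ∀ i, ρ (e i) = D.opE i)
    (hρf : ∀ i, ρ (f i) = D.opF i) (hρt : ∀ g, ρ (t g) = D.opT g) :
    Function.Bijective H.mulMap := by
  have hmul : ∀ (z : R) (v : D.Triangular), H.mulMap (ρ z v) = z * H.mulMap v := by
    intro z
    have hz : z ∈ Algebra.adjoin K (Set.range e ∪ Set.range f ∪ Set.range t) := hgen ▸ trivial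
    induction hz using Algebra.adjoin_induction with
    | mem z hz =>
      rcases hz with (⟨i, rfl⟩ | ⟨i, rfl⟩) | ⟨g, rfl⟩
      · rw [hρe]; exact H.mulMap_opE i
      · rw [hρf]; exact H.mulMap_opF i
      · rw [hρt]; exact H.mulMap_opT g
    | algebraMap c =>
      intro v
      rw [AlgHom.commutes, Module.algebraMap_end_apply, map_smul, Algebra.smul_def]
    | add x y _ _ hx hy => intro v; rw [map_add, LinearMap.add_apply, map_add, hx, hy, add_mul]
    | mul x y _ _ hx hy => intro v; rw [map_mul, Module.End.mul_apply, hx, hy, mul_assoc]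
  have h₁ : ∀ x : D.Pos, ρ (H.pos x) ((1 ⊗ₜ 1) ⊗ₜ 1) = ((1 : D.Neg) ⊗ₜ (1 : Tor K ι)) ⊗ₜ x := by
    intro x
    induction x using pos_induction with
    | one => simp
    | add x y hx hy => simp only [map_add, LinearMap.add_apply, hx, hy, TensorProduct.tmul_add]
    | smul c x hx => simp only [map_smul, LinearMap.smul_apply, hx, TensorProduct.tmul_smul]
    | gen_mul i x hx =>
      rw [map_mul, map_mul, Module.End.mul_apply, hx, pos_gen, hρe, opE_one_one]
  have h₂ : ∀ (u : Tor K ι) (x : D.Pos),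
      ρ (H.torus u) ((1 ⊗ₜ 1) ⊗ₜ x) = ((1 : D.Neg) ⊗ₜ u) ⊗ₜ x := by
    intro u x
    induction u using tor_induction with
    | one => simp
    | add u v hu hv =>
      simp only [map_add, LinearMap.add_apply, hu, hv, TensorProduct.tmul_add,
        TensorProduct.add_tmul]
    | smul c u hu =>
      simp only [map_smul, LinearMap.smul_apply, hu, TensorProduct.tmul_smul,
        TensorProduct.smul_tmul']
    | gen_mul g u hu =>
      rw [map_mul, map_mul, Module.End.mul_apply, hu, torus_gen, hρt, opT_tmul, map_one]
  have h₃ : ∀ (y : D.Neg) (u : Tor K ι) (x : D.Pos),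
      ρ (H.neg y) ((1 ⊗ₜ u) ⊗ₜ x) = (y ⊗ₜ u) ⊗ₜ x := by
    intro y u x
    induction y using neg_induction with
    | one => simp
    | add y z hy hz => simp only [map_add, LinearMap.add_apply, hy, hz, TensorProduct.add_tmul]
    | smul c y hy =>
      simp only [map_smul, LinearMap.smul_apply, hy, TensorProduct.smul_tmul']
    | gen_mul i y hy =>
      rw [map_mul, map_mul, Module.End.mul_apply, hy, neg_gen, hρf, opF_tmul]
  have hinv : ∀ v, ρ (H.mulMap v) ((1 ⊗ₜ 1) ⊗ₜ 1) = v :=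
    LinearMap.congr_fun (f := (LinearMap.applyₗ ((1 ⊗ₜ 1) ⊗ₜ 1 : D.Triangular)) ∘ₗ
      ρ.toLinearMap ∘ₗ H.mulMap) (g := LinearMap.id)
      (TensorProduct.ext_threefold fun y u x => by
        simp [mulMap_tmul, h₁, h₂, h₃])
  refine ⟨Function.LeftInverse.injective (g := fun z => ρ z ((1 ⊗ₜ 1) ⊗ₜ 1)) hinv,
    fun z => ⟨ρ z ((1 ⊗ₜ 1) ⊗ₜ 1), ?_⟩⟩
  rw [hmul, mulMap_tmul]
  simp

theorem exists_equiv_adjoin (H : D.Realization e f t)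
    (hgen : Algebra.adjoin K (Set.range e ∪ Set.range f ∪ Set.range t) = ⊤)
    (ρ : R →ₐ[K] Module.End K D.Triangular) (hρe : ∀ i, ρ (e i) = D.opE i)
    (hρf : ∀ i, ρ (f i) = D.opF i) (hρt : ∀ g, ρ (t g) = D.opT g) :
    ∃ T : (Algebra.adjoin K (Set.range f) ⊗[K] Algebra.adjoin K (Set.range t)) ⊗[K]
        Algebra.adjoin K (Set.range e) ≃ₗ[K] R,
      ∀ (y : Algebra.adjoin K (Set.range f)) (u : Algebra.adjoin K (Set.range t))
        (x : Algebra.adjoin K (Set.range e)), T ((y ⊗ₜ u) ⊗ₜ x) = (y : R) * u * x :=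
  exists_equiv_of_bijective_tripleMul (H.bijective_mulMap hgen ρ hρe hρf hρt)
    (range_negLift _) (range_torLift _ _) (range_posLift _)

end Realization

end QuantumDatum

section Specialization

variable {n : ℕ} (a : Fin n → Fin n → ℤ) (d : Fin n → ℤ)

theorem rr_ne_zero : rr ≠ 0 := by simp [rr]

theorem ss_ne_zero : ss ≠ 0 := by simp [ss]

theorem eulB_self (i : Fin n) : eulB a d i i = d i := by simp [eulB]

theorem eulB_add_eulB {a : Fin n → Fin n → ℤ} {d : Fin n → ℤ}
    (hsym : ∀ i j, d i * a i j = d j * a j i) {i j : Fin n} (h : i ≠ j) :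
    eulB a d i j + eulB a d j i = d i * a i j := by
  rcases lt_or_gt_of_ne h with h' | h'
  · simp [eulB, h', h'.not_gt, h.symm]
  · simp [eulB, h', h'.not_gt, h, hsym j i]

/-- The datum of the two-parameter quantum group. -/
def twoParameterDatum {a : Fin n → Fin n → ℤ} {d : Fin n → ℤ}
    (hoff : ∀ i j, i ≠ j → a i j ≤ 0) (hsym : ∀ i j, d i * a i j = d j * a j i) :
    QuantumDatum K2 (Fin n) where
  P i j := rr ^ eulB a d j i * (ss ^ eulB a d i j)⁻¹
  κ i := (rr ^ d i - ss ^ d i)⁻¹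
  N i j := (1 - a i j).toNat
  P_ne_zero i j := mul_ne_zero (zpow_ne_zero _ rr_ne_zero) (inv_ne_zero (zpow_ne_zero _ ss_ne_zero))
  N_ne_zero i j h := by have := hoff i j h; omega
  cartan i j h := by
    have hN : ((1 - a i j).toNat : ℤ) = 1 - a i j := Int.toNat_of_nonneg (by
      have := hoff i j h; omega)
    have hE := eulB_add_eulB hsym h
    rw [← zpow_natCast, hN, eulB_self, ← zpow_neg, ← zpow_neg, ← zpow_neg, mul_zpow, ← zpow_mul,
      ← zpow_mul]
    have e : ∀ x y z w v u : K2, x * y * (z * w) * (u * v) = (x * z * u) * (y * w * v) := by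
      intros; ring
    rw [e, ← zpow_add₀ rr_ne_zero, ← zpow_add₀ rr_ne_zero, ← zpow_add₀ ss_ne_zero,
      ← zpow_add₀ ss_ne_zero]
    congr 2
    · linear_combination hE
    · linear_combination -hE

variable {a d} (hoff : ∀ i j, i ≠ j → a i j ≤ 0) (hsym : ∀ i j, d i * a i j = d j * a j i)

theorem ccoef_eq (i j : Fin n) (k : ℕ) : ccoef a d rr ss i j k =
    (twoParameterDatum hoff hsym).P i i ^ (k * (k - 1) / 2) *
      (twoParameterDatum hoff hsym).P i j ^ k := by
  simp only [ccoef, twoParameterDatum, eulB_self, mul_pow, inv_pow, mul_comm (k : ℤ), zpow_mul,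
    zpow_natCast, mul_assoc]

theorem serreElt_eq {A : Type} [Ring A] [Algebra K2 A] (E : Fin n → A) (i j : Fin n) :
    serreElt a d rr ss E i j = skewAd' ((twoParameterDatum hoff hsym).P i i)
      ((twoParameterDatum hoff hsym).P i j) (E i) (E j) ((twoParameterDatum hoff hsym).N i j) := by
  rw [skewAd'_eq_sum]
  simp only [serreElt, ccoef_eq hoff hsym]
  simp only [twoParameterDatum, eulB_self]

theorem serreEltF_eq {A : Type} [Ring A] [Algebra K2 A] (F : Fin n → A) (i j : Fin n) :
    serreEltF a d rr ss F i j = skewAd ((twoParameterDatum hoff hsym).P i i)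
      ((twoParameterDatum hoff hsym).P i j) (F i) (F j) ((twoParameterDatum hoff hsym).N i j) := by
  rw [skewAd_eq_sum]
  simp only [serreEltF, ccoef_eq hoff hsym]
  simp only [twoParameterDatum, eulB_self]

/-- Relation for the inverse of a skew commuting element. -/
theorem inv_mul_eq_smul {K A : Type} [Field K] [Ring A] [Algebra K A] {w v x : A} {c : K}
    (hc : c ≠ 0) (h₁ : w * v = 1) (h₂ : v * w = 1) (h : w * x = c • (x * w)) :
    v * x = c⁻¹ • (x * v) := by
  have e : x * v = c • (v * x) := by
    calc x * v = v * (w * x) * v := by rw [← mul_assoc v, h₂, one_mul]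
      _ = c • (v * x) := by
        rw [h, mul_smul_comm, smul_mul_assoc, ← mul_assoc, mul_assoc, h₁, mul_one]
  rw [e, smul_smul, inv_mul_cancel₀ hc, one_smul]

section Relations

variable {R : Type} [Ring R] [Algebra K2 R] {g : Gen n → R}

theorem realization_of_rel
    (h : ∀ x y, URel a d x y → FreeAlgebra.lift K2 g x = FreeAlgebra.lift K2 g y) :
    (twoParameterDatum hoff hsym).Realization (fun i => g (Gen.e i)) (fun i => g (Gen.f i))
      fun p => g (tor p.1 p.2.1 p.2.2) := by
  have wr i : g (Gen.w i) * g (Gen.winv i) = 1 := by simpa using h _ _ (URel.wInvR i)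
  have wl i : g (Gen.winv i) * g (Gen.w i) = 1 := by simpa using h _ _ (URel.wInvL i)
  have wr' i : g (Gen.w' i) * g (Gen.w'inv i) = 1 := by simpa using h _ _ (URel.w'InvR i)
  have wl' i : g (Gen.w'inv i) * g (Gen.w' i) = 1 := by simpa using h _ _ (URel.w'InvL i)
  set D := twoParameterDatum hoff hsym
  have we i j : g (Gen.w i) * g (Gen.e j) = D.P i j • (g (Gen.e j) * g (Gen.w i)) := by
    simpa [D, twoParameterDatum] using h _ _ (URel.we i j)
  have we' i j : g (Gen.w' i) * g (Gen.e j) = (D.P j i)⁻¹ • (g (Gen.e j) * g (Gen.w' i)) := by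
    simpa [D, twoParameterDatum, mul_comm] using h _ _ (URel.w'e i j)
  have wf i j : g (Gen.w i) * g (Gen.f j) = (D.P i j)⁻¹ • (g (Gen.f j) * g (Gen.w i)) := by
    simpa [D, twoParameterDatum, mul_comm] using h _ _ (URel.wf i j)
  have wf' i j : g (Gen.w' i) * g (Gen.f j) = D.P j i • (g (Gen.f j) * g (Gen.w' i)) := by
    simpa [D, twoParameterDatum] using h _ _ (URel.w'f i j)
  have hP := D.P_ne_zero
  constructor
  · constructor
    · intro p q
      simpa using h _ _ (URel.torComm p.1 q.1 p.2.1 p.2.2 q.2.1 q.2.2)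
    · rintro i (_ | _)
      exacts [wr i, wr' i]
    · rintro ⟨i, _ | _, _ | _⟩ j
      · exact we i j
      · exact inv_mul_eq_smul (hP i j) (wr i) (wl i) (we i j)
      · exact we' i j
      · simpa [QuantumDatum.weight, tor] using
          inv_mul_eq_smul (inv_ne_zero (hP j i)) (wr' i) (wl' i) (we' i j)
    · rintro ⟨i, _ | _, _ | _⟩ j
      · exact wf i j
      · exact inv_mul_eq_smul (inv_ne_zero (hP i j)) (wr i) (wl i) (wf i j)
      · simpa [QuantumDatum.weight, tor] using wf' i j
      · exact inv_mul_eq_smul (hP j i) (wr' i) (wl' i) (wf' i j)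
    · intro i j
      have := h _ _ (URel.ef i j)
      split_ifs at this ⊢
      · simpa [D, twoParameterDatum, tor] using this
      · simpa using this
  · intro i j hij
    have := h _ _ (URel.serreE i j hij)
    rwa [serreElt_eq hoff hsym, map_skewAd', map_zero, FreeAlgebra.lift_ι_apply,
      FreeAlgebra.lift_ι_apply] at this
  · intro i j hij
    have := h _ _ (URel.serreF i j hij)
    rwa [serreEltF_eq hoff hsym, map_skewAd, map_zero, FreeAlgebra.lift_ι_apply,
      FreeAlgebra.lift_ι_apply] at this

theorem rel_of_realization
    (H : (twoParameterDatum hoff hsym).Realization (fun i => g (Gen.e i)) (fun i => g (Gen.f i))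
      fun p => g (tor p.1 p.2.1 p.2.2)) {x y : FreeAlgebra K2 (Gen n)} (h : URel a d x y) :
    FreeAlgebra.lift K2 g x = FreeAlgebra.lift K2 g y := by
  cases h with
  | torComm i j p q p' q' => simpa using H.t_comm (i, p, q) (j, p', q')
  | wInvR i => simpa [tor] using H.t_inv i false
  | wInvL i =>
    have := H.t_inv i false
    rw [H.t_comm] at this
    simpa [tor] using this
  | w'InvR i => simpa [tor] using H.t_inv i true
  | w'InvL i =>
    have := H.t_inv i true
    rw [H.t_comm] at this
    simpa [tor] using this
  | we i j => simpa [QuantumDatum.weight, twoParameterDatum, tor] using H.t_e (i, false, false) j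
  | w'e i j =>
    simpa [QuantumDatum.weight, twoParameterDatum, tor, mul_comm] using H.t_e (i, true, false) j
  | wf i j =>
    simpa [QuantumDatum.weight, twoParameterDatum, tor, mul_comm] using H.t_f (i, false, false) j
  | w'f i j =>
    simpa [QuantumDatum.weight, twoParameterDatum, tor, mul_comm] using H.t_f (i, true, false) j
  | ef i j =>
    have := H.e_f i j
    split_ifs at this ⊢
    · simpa [twoParameterDatum, tor] using this
    · simpa using this
  | serreE i j hij =>
    rw [serreElt_eq hoff hsym, map_skewAd', map_zero, FreeAlgebra.lift_ι_apply,
      FreeAlgebra.lift_ι_apply]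
    exact H.serre_e i j hij
  | serreF i j hij =>
    rw [serreEltF_eq hoff hsym, map_skewAd, map_zero, FreeAlgebra.lift_ι_apply,
      FreeAlgebra.lift_ι_apply]
    exact H.serre_f i j hij

end Relations

theorem realization_gU : (twoParameterDatum hoff hsym).Realization (fun i => gU a d (Gen.e i))
    (fun i => gU a d (Gen.f i)) fun p => gU a d (tor p.1 p.2.1 p.2.2) := by
  refine realization_of_rel hoff hsym fun x y h => ?_
  have e : FreeAlgebra.lift K2 (gU a d) = RingQuot.mkAlgHom K2 (URel a d) := by
    ext; simp [gU]
  rw [e]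
  exact RingQuot.mkAlgHom_rel K2 h

theorem adjoin_gU : Algebra.adjoin K2 ((Set.range fun i => gU a d (Gen.e i)) ∪
    (Set.range fun i => gU a d (Gen.f i)) ∪
    Set.range fun p : Fin n × Bool × Bool => gU a d (tor p.1 p.2.1 p.2.2)) = ⊤ := by
  refine top_unique ?_
  rw [← RingQuot.adjoin_range_mkAlgHom_ι]
  refine Algebra.adjoin_mono ?_
  rintro _ ⟨x, rfl⟩
  cases x with
  | e i => exact Or.inl (Or.inl ⟨i, rfl⟩)
  | f i => exact Or.inl (Or.inr ⟨i, rfl⟩)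
  | w i => exact Or.inr ⟨(i, false, false), rfl⟩
  | winv i => exact Or.inr ⟨(i, false, true), rfl⟩
  | w' i => exact Or.inr ⟨(i, true, false), rfl⟩
  | w'inv i => exact Or.inr ⟨(i, true, true), rfl⟩

/-- The operators on the triangular space attached to the generators. -/
def genOp (D : QuantumDatum K2 (Fin n)) : Gen n → Module.End K2 D.Triangular
  | .e i => D.opE i
  | .f i => D.opF i
  | .w i => D.opT (i, false, false)
  | .winv i => D.opT (i, false, true)
  | .w' i => D.opT (i, true, false)
  | .w'inv i => D.opT (i, true, true)

theorem genOp_tor (D : QuantumDatum K2 (Fin n)) :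
    (fun p => genOp D (tor p.1 p.2.1 p.2.2)) = D.opT := by
  ext1 ⟨i, _ | _, _ | _⟩ <;> rfl

/-- The regular representation on the triangular space. -/
def regularRep : Uq a d →ₐ[K2] Module.End K2 (twoParameterDatum hoff hsym).Triangular :=
  RingQuot.liftAlgHom K2 ⟨FreeAlgebra.lift K2 (genOp (twoParameterDatum hoff hsym)), fun _ _ h =>
    rel_of_realization hoff hsym (by
      rw [genOp_tor]
      exact (twoParameterDatum hoff hsym).realization_op) h⟩

theorem regularRep_gU (x : Gen n) :
    regularRep hoff hsym (gU a d x) = genOp (twoParameterDatum hoff hsym) x := by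
  simp [regularRep, gU]

end Specialization

/-- **Corollary 2.6 (triangular decomposition).** The multiplication map
`U⁻ ⊗ U⁰ ⊗ U⁺ → U_{r,s}(𝔤)`, `y ⊗ t ⊗ x ↦ y t x`, is an isomorphism of
`ℚ(r,s)`-vector spaces. -/
theorem triangular_decomposition
    (n : ℕ) (a : Fin n → Fin n → ℤ) (d : Fin n → ℤ)
    (hdiag : ∀ i, a i i = 2) (hoff : ∀ i j, i ≠ j → a i j ≤ 0)
    (hsym : ∀ i j, d i * a i j = d j * a j i) (hdpos : ∀ i, 0 < d i)
    (hfin : Matrix.PosDef (Matrix.of fun i j : Fin n => ((d i * a i j : ℤ) : ℝ))) :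
    ∃ T : (↥(Uneg a d) ⊗[K2] ↥(Uzero a d)) ⊗[K2] ↥(Upos a d) ≃ₗ[K2] Uq a d,
      ∀ (y : ↥(Uneg a d)) (t : ↥(Uzero a d)) (x : ↥(Upos a d)),
        T ((y ⊗ₜ[K2] t) ⊗ₜ[K2] x) = (y : Uq a d) * (t : Uq a d) * (x : Uq a d) := by
  exact (realization_gU hoff hsym).exists_equiv_adjoin adjoin_gU (regularRep hoff hsym)
    (fun _ => regularRep_gU hoff hsym _) (fun _ => regularRep_gU hoff hsym _)
    (fun g => (regularRep_gU hoff hsym _).trans (congrFun (genOp_tor _) g))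

end
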